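/- Lemma (nonvanishing of the evaluated even character, sl(m|n) case): For all c, d ∈ ℕ^{m+n−2} and all a, b ∈ ℂ, setting λ = λ_a^c and μ = λ_b^d, the formal power series N(λ,μ) := Σ_{w∈W} ε(w)·exp(⟨w(λ+ρ), μ+ρ⟩·h) is a nonzero element of ℂ[[h]]. (This is the claim φ_{μ+ρ}(χ₀(λ)) ≠ 0 used in the proof that S'(λ,μ) ≠ 0 for typical μ.) -/

import Mathlib

/-!
Lemma (nonvanishing of the evaluated even character, sl(m|n) case).
-/

open scoped BigOperators

noncomputable section

namespace SLmn

/-- The weight space `V = ℂ^{m+n}`, with coordinates `ε_1,…,ε_m,δ_1,…,δ_n`. -/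
abbrev V (m n : ℕ) := Fin (m + n) → ℂ

variable (m n : ℕ)

/-- The basis vector `ε_i` (here `i : Fin m` is the 0-based index). -/
def eps (i : Fin m) : V m n := Pi.single (Fin.castAdd n i) 1

/-- The basis vector `δ_j`. -/
def delta (j : Fin n) : V m n := Pi.single (Fin.natAdd m j) 1

/-- The symmetric bilinear form with `⟨ε_i,ε_j⟩ = δ_{ij}`, `⟨δ_i,δ_j⟩ = -δ_{ij}`,
`⟨ε_i,δ_j⟩ = 0`. -/
def form (x y : V m n) : ℂ :=
  (∑ i : Fin m, x (Fin.castAdd n i) * y (Fin.castAdd n i)) -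
    ∑ j : Fin n, x (Fin.natAdd m j) * y (Fin.natAdd m j)

/-- `ρ₀ = ½(Σ_i (m+1-2i)ε_i + Σ_j (n+1-2j)δ_j)` (1-based indices). -/
def rho0 : V m n :=
  (1 / 2 : ℂ) •
    ((∑ i : Fin m, ((m : ℂ) + 1 - 2 * ((i : ℕ) + 1)) • eps m n i) +
      ∑ j : Fin n, ((n : ℂ) + 1 - 2 * ((j : ℕ) + 1)) • delta m n j)

/-- `ρ₁ = ½(n Σ_i ε_i - m Σ_j δ_j)`. -/
def rho1 : V m n :=
  (1 / 2 : ℂ) • ((n : ℂ) • ∑ i : Fin m, eps m n i - (m : ℂ) • ∑ j : Fin n, delta m n j)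

/-- `ρ = ρ₀ - ρ₁`. -/
def rho : V m n := rho0 m n - rho1 m n

/-- The fundamental weight `w_k` (1-based `k`): `w_k = ε_1 + ⋯ + ε_k` for `1 ≤ k ≤ m`,
and `w_{m+k} = -(δ_{k+1} + ⋯ + δ_n)` for `1 ≤ k ≤ n-1`. -/
def w (k : ℕ) : V m n :=
  if k ≤ m then ∑ i ∈ Finset.univ.filter fun i : Fin m => (i : ℕ) < k, eps m n i
  else -∑ j ∈ Finset.univ.filter fun j : Fin n => k - m ≤ (j : ℕ), delta m n j

/-- The index of the fundamental weight attached to the `k`-th entry (0-based) of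
`c = (c_1,…,c_{m+n-2})`: `c_1,…,c_{m-1}` go with `w_1,…,w_{m-1}` and
`c_m,…,c_{m+n-2}` go with `w_{m+1},…,w_{m+n-1}`. -/
def wIdx (m k : ℕ) : ℕ := if k + 1 < m then k + 1 else k + 2

/-- The weight `λ_a^c = c_1 w_1 + ⋯ + c_{m-1} w_{m-1} + a·w_m + c_m w_{m+1} + ⋯ +
c_{m+n-2} w_{m+n-1}`. -/
def lam (c : Fin (m + n - 2) → ℕ) (a : ℂ) : V m n :=
  a • w m n m + ∑ k : Fin (m + n - 2), (c k : ℂ) • w m n (wIdx m k)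

/-- `λ` is typical if `⟨λ+ρ,α⟩ ≠ 0` for every odd positive root `α = ε_i - δ_j`. -/
def Typical (x : V m n) : Prop :=
  ∀ (i : Fin m) (j : Fin n), form m n (x + rho m n) (eps m n i - delta m n j) ≠ 0

/-- `exp(z h) ∈ ℂ[[h]]`. -/
def exph (z : ℂ) : PowerSeries ℂ := PowerSeries.mk fun j => z ^ j / (j.factorial : ℂ)

/-- `q^z := exp(zh/2)`. -/
def qpow (z : ℂ) : PowerSeries ℂ := exph (z / 2)

/-- `{z} := q^z - q^{-z}`. -/
def brace (z : ℂ) : PowerSeries ℂ := qpow z - qpow (-z)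

/-- `Π_{α ∈ Δ₀⁺} {⟨x,α⟩}` where `Δ₀⁺ = {ε_i-ε_j}_{i<j} ∪ {δ_i-δ_j}_{i<j}`. -/
def evenProd (x : V m n) : PowerSeries ℂ :=
  (∏ p ∈ Finset.univ.filter fun p : Fin m × Fin m => p.1 < p.2,
      brace (form m n x (eps m n p.1 - eps m n p.2))) *
    ∏ p ∈ Finset.univ.filter fun p : Fin n × Fin n => p.1 < p.2,
      brace (form m n x (delta m n p.1 - delta m n p.2))

/-- `Π_{α ∈ Δ₁⁺} {⟨x,α⟩}` where `Δ₁⁺ = {ε_i - δ_j}`. -/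
def oddProd (x : V m n) : PowerSeries ℂ :=
  ∏ p : Fin m × Fin n, brace (form m n x (eps m n p.1 - delta m n p.2))

/-- The action of `W = S_m × S_n` on `V`, permuting the `ε`-coordinates and the
`δ`-coordinates separately. -/
def act (σ : Equiv.Perm (Fin m)) (τ : Equiv.Perm (Fin n)) (x : V m n) : V m n :=
  fun k =>
    Sum.elim (fun i => x (Fin.castAdd n (σ⁻¹ i))) (fun j => x (Fin.natAdd m (τ⁻¹ j)))
      (finSumFinEquiv.symm k)

/-- The sign `ε(w) = sgn(σ)·sgn(τ)` of `w = (σ,τ) ∈ W`, as a complex number. -/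
def sgn (σ : Equiv.Perm (Fin m)) (τ : Equiv.Perm (Fin n)) : ℂ :=
  (((Equiv.Perm.sign σ : ℤ) * (Equiv.Perm.sign τ : ℤ) : ℤ) : ℂ)

/-- `N(λ,μ) = Σ_{w ∈ W} ε(w)·exp(⟨w(λ+ρ), μ+ρ⟩·h) ∈ ℂ[[h]]`. -/
def Npair (x y : V m n) : PowerSeries ℂ :=
  ∑ σ : Equiv.Perm (Fin m), ∑ τ : Equiv.Perm (Fin n),
    sgn m n σ τ • exph (form m n (act m n σ τ (x + rho m n)) (y + rho m n))

/-- The inclusion `ℂ[[h]] → ℂ((h))`. -/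
def toL : PowerSeries ℂ →+* LaurentSeries ℂ := HahnSeries.ofPowerSeries ℤ ℂ

/-- The fake quantum dimension
`d(λ) = (Π_{α∈Δ₀⁺} {⟨λ+ρ,α⟩}) / ((Π_{α∈Δ₁⁺} {⟨λ+ρ,α⟩})·(Π_{α∈Δ₀⁺} {⟨ρ,α⟩})) ∈ ℂ((h))`. -/
def dFake (x : V m n) : LaurentSeries ℂ :=
  toL (evenProd m n (x + rho m n)) /
    (toL (oddProd m n (x + rho m n)) * toL (evenProd m n (rho m n)))

/-- `Π_{α ∈ Δ₀⁺} {⟨α, y+ρ⟩}`. -/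
def evenProdR (y : V m n) : PowerSeries ℂ :=
  (∏ p ∈ Finset.univ.filter fun p : Fin m × Fin m => p.1 < p.2,
      brace (form m n (eps m n p.1 - eps m n p.2) (y + rho m n))) *
    ∏ p ∈ Finset.univ.filter fun p : Fin n × Fin n => p.1 < p.2,
      brace (form m n (delta m n p.1 - delta m n p.2) (y + rho m n))

/-- `Π_{α ∈ Δ₁⁺} {⟨α, y+ρ⟩}`. -/
def oddProdR (y : V m n) : PowerSeries ℂ :=
  ∏ p : Fin m × Fin n, brace (form m n (eps m n p.1 - delta m n p.2) (y + rho m n))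

/-- The modified Hopf-link pairing
`S'(λ,μ) = (Π_{α∈Δ₁⁺} {⟨α,μ+ρ⟩}) · N(λ,μ) / (Π_{α∈Δ₀⁺} {⟨α,μ+ρ⟩}) ∈ ℂ((h))`. -/
def Spair (x y : V m n) : LaurentSeries ℂ :=
  toL (oddProdR m n y) * toL (Npair m n x y) / toL (evenProdR m n y)

/-- A linear combination of exponential series does not vanish as soon as some exponent occurs
exactly once, with a nonzero coefficient. -/
lemma sum_smul_exph_ne_zero {ι : Type*} [Fintype ι] [DecidableEq ι] (s z : ι → ℂ) (i₀ : ι)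
    (hs : s i₀ ≠ 0) (hz : ∀ i, i ≠ i₀ → z i ≠ z i₀) : ∑ i, s i • exph (z i) ≠ 0 := by
  intro h
  have hpow (j : ℕ) : ∑ i, s i * z i ^ j = 0 := by
    have hj := congrArg (PowerSeries.coeff j) h
    simp only [exph, map_sum, PowerSeries.coeff_smul, PowerSeries.coeff_mk, smul_eq_mul, map_zero,
      ← mul_div_assoc, ← Finset.sum_div] at hj
    exact (div_eq_zero_iff.mp hj).resolve_right (by exact_mod_cast j.factorial_ne_zero)
  have heval (p : Polynomial ℂ) : ∑ i, s i * p.eval (z i) = 0 := by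
    simp only [Polynomial.eval_eq_sum_range, Finset.mul_sum]
    rw [Finset.sum_comm]
    refine Finset.sum_eq_zero fun j _ => ?_
    simp only [mul_left_comm (s _), ← Finset.mul_sum, hpow, mul_zero]
  have hp := heval (∏ i ∈ Finset.univ.erase i₀, (Polynomial.X - Polynomial.C (z i)))
  simp only [Polynomial.eval_prod, Polynomial.eval_sub, Polynomial.eval_X, Polynomial.eval_C] at hp
  rw [Finset.sum_eq_single i₀ _ (by simp)] at hp
  · refine mul_ne_zero hs (Finset.prod_ne_zero_iff.mpr fun i hi => ?_) hp
    exact sub_ne_zero.mpr (hz i (Finset.ne_of_mem_erase hi)).symm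
  · intro i _ hi
    rw [Finset.prod_eq_zero (Finset.mem_erase.mpr ⟨hi, Finset.mem_univ i⟩) (sub_self _), mul_zero]

/-- Strict rearrangement inequality for strictly decreasing sequences. -/
lemma sum_comp_perm_inv_mul_lt {k : ℕ} {u v : Fin k → ℝ} (hu : StrictAnti u) (hv : StrictAnti v)
    {σ : Equiv.Perm (Fin k)} (hσ : σ ≠ 1) : ∑ i, u (σ⁻¹ i) * v i < ∑ i, u i * v i := by
  have hmono : Monovary u v := hu.antitone.monovary hv.antitone
  refine hmono.sum_comp_perm_mul_lt_sum_mul_iff.mpr fun h => hσ ?_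
  have hσ' : StrictMono (σ⁻¹ : Equiv.Perm (Fin k)) := by
    refine Monotone.strictMono_of_injective (fun i j hij => ?_) (Equiv.injective _)
    rcases hij.eq_or_lt with rfl | hlt
    · exact le_rfl
    · exact hu.le_iff_ge.mp (h (hv hlt))
  refine inv_eq_one.mp (Equiv.ext fun i => ?_)
  exact congrFun ((hσ'.range_inj strictMono_id).mp (by simp)) i

/-- The reversal is the strict minimizer in the rearrangement inequality. -/
lemma sum_comp_rev_mul_lt {k : ℕ} {u v : Fin k → ℝ} (hu : StrictAnti u) (hv : StrictAnti v)
    {τ : Equiv.Perm (Fin k)} (hτ : τ ≠ Fin.revPerm) :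
    ∑ j, u (Fin.revPerm⁻¹ j) * v j < ∑ j, u (τ⁻¹ j) * v j := by
  have hu' : StrictAnti fun j => -u (Fin.rev j) :=
    fun i j hij => neg_lt_neg (hu (Fin.rev_lt_rev.mpr hij))
  have hne : τ * Fin.revPerm ≠ 1 := by
    intro h
    exact hτ ((eq_inv_of_mul_eq_one_left h).trans (Equiv.ext fun _ => rfl))
  have := sum_comp_perm_inv_mul_lt hu' hv hne
  simpa [neg_mul, Finset.sum_neg_distrib, mul_inv_rev] using this

/-- Translating both arguments changes all permuted products by the same constant. -/
lemma exists_sum_comp_perm_inv_mul_eq {k : ℕ} {x y : Fin k → ℂ} {u v : Fin k → ℝ} {α β : ℂ}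
    (hx : ∀ i, x i = α + u i) (hy : ∀ i, y i = β + v i) :
    ∃ C : ℂ, ∀ σ : Equiv.Perm (Fin k),
      ∑ i, x (σ⁻¹ i) * y i = C + ((∑ i, u (σ⁻¹ i) * v i : ℝ) : ℂ) := by
  refine ⟨∑ i, α * y i + ∑ i, u i * β, fun σ => ?_⟩
  rw [← Equiv.sum_comp σ⁻¹ fun i => (u i : ℂ) * β]
  push_cast
  rw [← Finset.sum_add_distrib, ← Finset.sum_add_distrib]
  refine Finset.sum_congr rfl fun i _ => ?_
  rw [hx, hy]
  ring

lemma eps_castAdd (i' i : Fin m) :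
    eps m n i' (Fin.castAdd n i) = if i = i' then 1 else 0 := by
  simp [eps, Pi.single_apply]

lemma eps_natAdd (i : Fin m) (j : Fin n) : eps m n i (Fin.natAdd m j) = 0 := by
  simp only [eps, Pi.single_apply, Fin.ext_iff, Fin.val_natAdd, Fin.val_castAdd]
  exact if_neg (by omega)

lemma delta_castAdd (j : Fin n) (i : Fin m) : delta m n j (Fin.castAdd n i) = 0 := by
  simp only [delta, Pi.single_apply, Fin.ext_iff, Fin.val_natAdd, Fin.val_castAdd]
  exact if_neg (by omega)

lemma delta_natAdd (j' j : Fin n) :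
    delta m n j' (Fin.natAdd m j) = if j = j' then 1 else 0 := by
  simp [delta, Pi.single_apply]

lemma w_castAdd (k : ℕ) (i : Fin m) :
    w m n k (Fin.castAdd n i) = if k ≤ m ∧ (i : ℕ) < k then 1 else 0 := by
  by_cases hk : k ≤ m <;> simp [w, hk, eps_castAdd, delta_castAdd, Finset.sum_apply]

lemma w_natAdd (k : ℕ) (j : Fin n) :
    w m n k (Fin.natAdd m j) = -if m < k ∧ k - m ≤ (j : ℕ) then 1 else 0 := by
  by_cases hk : k ≤ m
  · simp [w, hk, eps_natAdd, Finset.sum_apply, not_lt.mpr hk]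
  · simp [w, hk, delta_natAdd, Finset.sum_apply, not_le.mp hk]

lemma rho_castAdd (i : Fin m) :
    rho m n (Fin.castAdd n i) = ((m : ℂ) - 1 - n) / 2 - (i : ℕ) := by
  simp [rho, rho0, rho1, eps_castAdd, delta_castAdd, Finset.sum_apply]
  ring

lemma rho_natAdd (j : Fin n) :
    rho m n (Fin.natAdd m j) = ((n : ℂ) - 1 + m) / 2 - (j : ℕ) := by
  simp [rho, rho0, rho1, eps_natAdd, delta_natAdd, Finset.sum_apply]
  ring

lemma exists_lam_add_rho_castAdd (c : Fin (m + n - 2) → ℕ) (a : ℂ) :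
    ∃ (α : ℂ) (u : Fin m → ℝ), StrictAnti u ∧
      ∀ i, (lam m n c a + rho m n) (Fin.castAdd n i) = α + u i := by
  refine ⟨a + ((m : ℂ) - 1 - n) / 2, fun i => (∑ k, (c k : ℝ) *
    if wIdx m k ≤ m ∧ (i : ℕ) < wIdx m k then 1 else 0) - (i : ℕ), fun i j hij => ?_, fun i => ?_⟩
  · refine (sub_lt_sub_left (Nat.cast_lt.mpr (Fin.lt_def.mp hij)) _).trans_le
      (sub_le_sub_right (Finset.sum_le_sum fun k _ => ?_) _)
    refine mul_le_mul_of_nonneg_left ?_ (Nat.cast_nonneg _)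
    have := Fin.lt_def.mp hij
    split_ifs <;> first | omega | norm_num
  · simp only [lam, Pi.add_apply, Pi.smul_apply, Finset.sum_apply, w_castAdd, rho_castAdd,
      smul_eq_mul]
    simp [apply_ite Complex.ofReal]
    ring

lemma exists_lam_add_rho_natAdd (c : Fin (m + n - 2) → ℕ) (a : ℂ) :
    ∃ (α : ℂ) (u : Fin n → ℝ), StrictAnti u ∧
      ∀ j, (lam m n c a + rho m n) (Fin.natAdd m j) = α + u j := by
  refine ⟨((n : ℂ) - 1 + m) / 2, fun j => -(∑ k, (c k : ℝ) *
    if m < wIdx m k ∧ wIdx m k - m ≤ (j : ℕ) then 1 else 0) - (j : ℕ), fun i j hij => ?_,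
    fun j => ?_⟩
  · refine (sub_lt_sub_left (Nat.cast_lt.mpr (Fin.lt_def.mp hij)) _).trans_le
      (sub_le_sub_right (neg_le_neg (Finset.sum_le_sum fun k _ => ?_)) _)
    refine mul_le_mul_of_nonneg_left ?_ (Nat.cast_nonneg _)
    have := Fin.lt_def.mp hij
    split_ifs <;> first | omega | norm_num
  · simp only [lam, Pi.add_apply, Pi.smul_apply, Finset.sum_apply, w_natAdd, rho_natAdd,
      smul_eq_mul]
    simp [apply_ite Complex.ofReal]
    ring

/-- Lemma (nonvanishing of the evaluated even character, sl(m|n) case): for all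
`c, d ∈ ℕ^{m+n-2}` and `a, b ∈ ℂ`, with `λ = λ_a^c` and `μ = λ_b^d`, the power series
`N(λ,μ) = Σ_{w∈W} ε(w)·exp(⟨w(λ+ρ), μ+ρ⟩·h)` is nonzero in `ℂ[[h]]`. -/
theorem Npair_ne_zero (hm : 1 ≤ m) (hn : 1 ≤ n) (hmn : m ≠ n)
    (c d : Fin (m + n - 2) → ℕ) (a b : ℂ) :
    Npair m n (lam m n c a) (lam m n d b) ≠ 0 := by
  obtain ⟨α, u, hu, hx⟩ := exists_lam_add_rho_castAdd m n c a
  obtain ⟨β, v, hv, hy⟩ := exists_lam_add_rho_castAdd m n d b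
  obtain ⟨α', u', hu', hx'⟩ := exists_lam_add_rho_natAdd m n c a
  obtain ⟨β', v', hv', hy'⟩ := exists_lam_add_rho_natAdd m n d b
  obtain ⟨C, hC⟩ := exists_sum_comp_perm_inv_mul_eq hx hy
  obtain ⟨C', hC'⟩ := exists_sum_comp_perm_inv_mul_eq hx' hy'
  rw [Npair, ← Fintype.sum_prod_type' (f := fun σ τ => sgn m n σ τ •
    exph (form m n (act m n σ τ (lam m n c a + rho m n)) (lam m n d b + rho m n)))]
  have hform (σ : Equiv.Perm (Fin m)) (τ : Equiv.Perm (Fin n)) :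
      form m n (act m n σ τ (lam m n c a + rho m n)) (lam m n d b + rho m n) =
        C - C' + ((∑ i, u (σ⁻¹ i) * v i - ∑ j, u' (τ⁻¹ j) * v' j : ℝ) : ℂ) := by
    simp only [form, act, finSumFinEquiv_symm_apply_castAdd, finSumFinEquiv_symm_apply_natAdd,
      Sum.elim_inl, Sum.elim_inr, hC, hC']
    push_cast
    ring
  refine sum_smul_exph_ne_zero (fun p : Equiv.Perm (Fin m) × Equiv.Perm (Fin n) => sgn m n p.1 p.2)
    _ (1, Fin.revPerm) ?_ ?_
  · rcases Int.units_eq_one_or (Equiv.Perm.sign (Fin.revPerm : Equiv.Perm (Fin n))) with h | h <;>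
      simp [sgn, h]
  · rintro ⟨σ, τ⟩ hne
    simp only [hform, ne_eq, add_right_inj, Complex.ofReal_inj]
    refine ne_of_lt ?_
    by_cases hσ : σ = 1
    · have hτ : τ ≠ Fin.revPerm := fun h => hne (by rw [hσ, h])
      simpa [hσ] using sum_comp_rev_mul_lt hu' hv' hτ
    · have h₁ := sum_comp_perm_inv_mul_lt hu hv hσ
      have h₂ : ∑ j, u' (Fin.revPerm⁻¹ j) * v' j ≤ ∑ j, u' (τ⁻¹ j) * v' j := by
        by_cases hτ : τ = Fin.revPerm
        · rw [hτ]
        · exact (sum_comp_rev_mul_lt hu' hv' hτ).le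
      simp only [inv_one, Equiv.Perm.one_apply]
      linarith

end SLmn
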